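/- arXiv:0909.1338 — 6 statements merged into one kernel-verified Lean document; each statement's English description precedes it below -/
import Mathlib

section
/- Let {g_i, h_i}_{i∈{0,1}} be a two-channel filterbank with finitely supported filters. Then it is a perfect reconstruction filterbank if and only if for all ω ∈ ℝ both ĝ_0(ω)·ĥ_0(ω) + ĝ_1(ω)·ĥ_1(ω) = 2 and ĝ_0(ω)·ĥ_0(ω−π) + ĝ_1(ω)·ĥ_1(ω−π) = 0 hold. -/
open scoped BigOperators

noncomputable section

/-- Discrete convolution `(f ⋆ x)[n] = Σ_m f[m]·x[n−m]` (a finite sum when `f` is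
finitely supported). -/
def conv (f x : ℤ → ℝ) (n : ℤ) : ℝ := ∑ᶠ m : ℤ, f m * x (n - m)

/-- One-level filterbank coefficient `v^x_i[n] = (g_i ⋆ x)[2n]`. -/
def fbCoeff (g x : ℤ → ℝ) (n : ℤ) : ℝ := conv g x (2 * n)

/-- Perfect reconstruction filterbank:
`x[n] = Σ_{i∈{0,1}} Σ_m h_i[n−2m]·v^x_i[m]` for all `x` and `n`. -/
def IsPR (g h : ZMod 2 → ℤ → ℝ) : Prop :=
  ∀ (x : ℤ → ℝ) (n : ℤ),
    x n = ∑ i : ZMod 2, ∑ᶠ m : ℤ, h i (n - 2 * m) * fbCoeff (g i) x m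

/-- Discrete-time Fourier transform `f̂(ω) = Σ_n f[n]·exp(−i·n·ω)`. -/
def dtft (f : ℤ → ℝ) (ω : ℝ) : ℂ :=
  ∑ᶠ n : ℤ, (f n : ℂ) * Complex.exp (-(Complex.I * (n : ℂ) * (ω : ℂ)))

/-- Analysis–synthesis symmetry with parameters `(a, b)`:
`ĝ_i(ω) = (−1)^{1−i}·a·exp(i(2b+1)ω)·ĥ_{1−i}(ω−π)`. -/
def SymmAS (g h : ZMod 2 → ℤ → ℝ) (a : ℝ) (b : ℤ) : Prop :=
  ∀ (i : ZMod 2) (ω : ℝ),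
    dtft (g i) ω
      = (-1 : ℂ) ^ (1 - i : ZMod 2).val * (a : ℂ)
        * Complex.exp (Complex.I * (2 * (b : ℂ) + 1) * (ω : ℂ))
        * dtft (h (1 - i)) (ω - Real.pi)

/-- Complementary analysis filter `g̃_i[n] = a·h_i[n + 2b + 1]`. -/
def compG (a : ℝ) (b : ℤ) (h : ℤ → ℝ) (n : ℤ) : ℝ := a * h (n + (2 * b + 1))

/-- Complementary synthesis filter `h̃_i[n] = a⁻¹·g_i[n − (2b + 1)]`. -/
def compH (a : ℝ) (b : ℤ) (g : ℤ → ℝ) (n : ℤ) : ℝ := a⁻¹ * g (n - (2 * b + 1))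

/-- Modulated sequence `x_m[n] = (−1)^n·x[n]`. -/
def modSeq (x : ℤ → ℝ) (n : ℤ) : ℝ := (-1 : ℝ) ^ n * x n

/-- Subsampled sequence: `x_s[n] = x[n]` for even `n`, and `0` for odd `n`. -/
def subSeq (x : ℤ → ℝ) (n : ℤ) : ℝ := if Even n then x n else 0

/-- Haar analysis filters: `g_i[0] = 1`, `g_i[−1] = (−1)^i`, else `0`. -/
def haarG (i : ZMod 2) (n : ℤ) : ℝ :=
  if n = 0 then 1 else if n = -1 then (-1 : ℝ) ^ i.val else 0

/-- Haar synthesis filters: `h_i[0] = 1/2`, `h_i[1] = (−1)^i/2`, else `0`. -/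
def haarH (i : ZMod 2) (n : ℤ) : ℝ :=
  if n = 0 then 1 / 2 else if n = 1 then (-1 : ℝ) ^ i.val / 2 else 0

/-- `L`-level filterbank coefficients `v^x_𝐢`; the bit `𝐢 0` is the level-0 bit,
applied first, then the remaining levels recursively. -/
def mCoeff (g : ZMod 2 → ℤ → ℝ) : (L : ℕ) → (Fin L → ZMod 2) → (ℤ → ℝ) → ℤ → ℝ
  | 0, _, x => x
  | L + 1, i, x => mCoeff g L (fun t => i t.succ) (fbCoeff (g (i 0)) x)

/-- `L`-level complementary coefficients `w^x_𝐢`: identical to `mCoeff` except that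
the level-0 filter is taken from the complementary bank `gt`. -/
def mCoeffW (g gt : ZMod 2 → ℤ → ℝ) : (L : ℕ) → (Fin L → ZMod 2) → (ℤ → ℝ) → ℤ → ℝ
  | 0, _, x => x
  | L + 1, i, x => mCoeff g L (fun t => i t.succ) (fbCoeff (gt (i 0)) x)

/-- `𝐢′`: flip the level-0 bit of `𝐢`. -/
def flip0 {L : ℕ} (i : Fin (L + 1) → ZMod 2) : Fin (L + 1) → ZMod 2 :=
  Function.update i 0 (1 - i 0)

/-- Convolution with a finitely supported filter as a sum over a finite set. -/
lemma conv_eq_sum {f : ℤ → ℝ} (hf : (Function.support f).Finite) (x : ℤ → ℝ) (n : ℤ) :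
    conv f x n = ∑ m ∈ hf.toFinset, f m * x (n - m) := by
  refine finsum_eq_sum_of_support_subset _ fun m hm => ?_
  simp only [Set.Finite.coe_toFinset, Function.mem_support] at hm ⊢
  exact left_ne_zero_of_mul hm

lemma support_shift_finite {f : ℤ → ℝ} (hf : (Function.support f).Finite) (m : ℤ) :
    (Function.support fun n => f (n - m)).Finite :=
  hf.preimage (f := fun n : ℤ => n - m) (sub_left_injective.injOn)

lemma support_conv_finite {f x : ℤ → ℝ} (hf : (Function.support f).Finite)
    (hx : (Function.support x).Finite) : (Function.support (conv f x)).Finite := by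
  refine (hf.add hx).subset fun n hn => ?_
  obtain ⟨m, hm⟩ : ∃ m, f m * x (n - m) ≠ 0 := by
    by_contra! h0
    exact hn (finsum_eq_zero_of_forall_eq_zero h0)
  exact ⟨m, left_ne_zero_of_mul hm, n - m, right_ne_zero_of_mul hm, by simp⟩

lemma support_modSeq_finite {f : ℤ → ℝ} (hf : (Function.support f).Finite) :
    (Function.support (modSeq f)).Finite :=
  hf.subset fun _ hn => right_ne_zero_of_mul hn

lemma conv_assoc {f g : ℤ → ℝ} (hf : (Function.support f).Finite)
    (hg : (Function.support g).Finite) (x : ℤ → ℝ) :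
    conv f (conv g x) = conv (conv f g) x := by
  funext n
  rw [conv_eq_sum hf]
  have h1 : ∀ m, f m * conv g x (n - m) = ∑ᶠ k, f m * (g (k - m) * x (n - k)) := by
    intro m
    rw [← mul_finsum, conv, ← finsum_comp_equiv (Equiv.subRight m)]
    congr 1
    refine finsum_congr fun k => ?_
    simp
  simp_rw [h1]
  rw [← finsum_sum_comm]
  · refine finsum_congr fun k => ?_
    rw [conv_eq_sum hf, Finset.sum_mul]
    exact Finset.sum_congr rfl fun m _ => by ring
  · intro m _
    refine (support_shift_finite hg m).subset fun k hk => ?_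
    exact left_ne_zero_of_mul (right_ne_zero_of_mul hk)

lemma modSeq_conv (f x : ℤ → ℝ) : modSeq (conv f x) = conv (modSeq f) (modSeq x) := by
  funext n
  simp only [modSeq, conv]
  rw [mul_finsum]
  refine finsum_congr fun m => ?_
  rw [show (-1 : ℝ) ^ n = (-1) ^ m * (-1) ^ (n - m) by
    rw [← zpow_add₀ (by norm_num)]; congr 1; ring]
  ring

lemma modSeq_modSeq (x : ℤ → ℝ) : modSeq (modSeq x) = x := by
  funext n
  rw [modSeq, modSeq, ← mul_assoc, ← mul_zpow]
  simp

/-- Upsampling after downsampling averages a signal with its modulation. -/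
lemma two_mul_finsum_even (h y : ℤ → ℝ) (hh : (Function.support h).Finite) (n : ℤ) :
    2 * ∑ᶠ m : ℤ, h (n - 2 * m) * y (2 * m) = conv h y n + conv h (modSeq y) n := by
  have hinj : Function.Injective fun m : ℤ => 2 * m := fun a b hab => by simpa using hab
  have h1 : ∑ᶠ m : ℤ, h (n - 2 * m) * y (2 * m)
      = ∑ᶠ p ∈ Set.range fun m : ℤ => 2 * m, h (n - p) * y p :=
    (finsum_mem_range (f := fun p => h (n - p) * y p) hinj).symm
  have hs : ∀ z : ℤ → ℝ, conv h z n = ∑ᶠ p, h (n - p) * z p := by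
    intro z
    rw [conv, ← finsum_comp_equiv (Equiv.subLeft n)]
    refine finsum_congr fun k => ?_
    simp
  have hfin : ∀ z : ℤ → ℝ, (Function.support fun p => h (n - p) * z p).Finite := fun z =>
    (hh.preimage (f := fun p : ℤ => n - p) (sub_right_injective.injOn)).subset
      fun p hp => left_ne_zero_of_mul hp
  rw [h1, finsum_mem_def, hs, hs, mul_finsum, ← finsum_add_distrib (hfin _) (hfin _)]
  refine finsum_congr fun p => ?_
  rcases Int.even_or_odd p with hp | hp
  · have : p ∈ Set.range fun m : ℤ => 2 * m := by
      obtain ⟨k, rfl⟩ := hp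
      exact ⟨k, by simp; ring⟩
    rw [Set.indicator_of_mem this, modSeq, hp.neg_one_zpow]
    ring
  · have : p ∉ Set.range fun m : ℤ => 2 * m := by
      rintro ⟨k, rfl⟩
      exact Int.not_even_iff_odd.2 hp (even_two_mul k)
    rw [Set.indicator_of_notMem this, modSeq, hp.neg_one_zpow]
    ring

/-- The transfer filter `Σ_i h_i ⋆ g_i`. -/
def transferFilter (g h : ZMod 2 → ℤ → ℝ) (n : ℤ) : ℝ :=
  conv (h 0) (g 0) n + conv (h 1) (g 1) n

lemma conv_add_left {f g : ℤ → ℝ} (hf : (Function.support f).Finite)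
    (hg : (Function.support g).Finite) (x : ℤ → ℝ) (n : ℤ) :
    conv (fun k => f k + g k) x n = conv f x n + conv g x n := by
  rw [conv, conv, conv, ← finsum_add_distrib]
  · exact finsum_congr fun m => add_mul _ _ _
  · exact hf.subset fun m hm => left_ne_zero_of_mul hm
  · exact hg.subset fun m hm => left_ne_zero_of_mul hm

lemma support_transferFilter_finite {g h : ZMod 2 → ℤ → ℝ}
    (hg : ∀ i : ZMod 2, (Function.support (g i)).Finite)
    (hh : ∀ i : ZMod 2, (Function.support (h i)).Finite) :
    (Function.support (transferFilter g h)).Finite :=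
  ((support_conv_finite (hh 0) (hg 0)).union (support_conv_finite (hh 1) (hg 1))).subset
    (Function.support_add _ _)

lemma conv_transferFilter {g h : ZMod 2 → ℤ → ℝ}
    (hg : ∀ i : ZMod 2, (Function.support (g i)).Finite)
    (hh : ∀ i : ZMod 2, (Function.support (h i)).Finite) (x : ℤ → ℝ) (n : ℤ) :
    conv (transferFilter g h) x n
      = conv (h 0) (conv (g 0) x) n + conv (h 1) (conv (g 1) x) n := by
  rw [conv_assoc (hh 0) (hg 0), conv_assoc (hh 1) (hg 1)]
  exact conv_add_left (support_conv_finite (hh 0) (hg 0)) (support_conv_finite (hh 1) (hg 1)) x n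

/-- The reconstructed signal splits into a transfer part and an alias part. -/
lemma two_mul_reconstruction {g h : ZMod 2 → ℤ → ℝ}
    (hg : ∀ i : ZMod 2, (Function.support (g i)).Finite)
    (hh : ∀ i : ZMod 2, (Function.support (h i)).Finite) (x : ℤ → ℝ) (n : ℤ) :
    2 * ∑ i : ZMod 2, ∑ᶠ m : ℤ, h i (n - 2 * m) * fbCoeff (g i) x m
      = conv (transferFilter g h) x n
        + conv (transferFilter (fun i => modSeq (g i)) h) (modSeq x) n := by
  rw [conv_transferFilter hg hh, conv_transferFilter (fun i => support_modSeq_finite (hg i)) hh,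
    ← modSeq_conv, ← modSeq_conv]
  have hsum : ∀ F : ZMod 2 → ℝ, ∑ i, F i = F 0 + F 1 := fun F => Fin.sum_univ_two F
  rw [hsum, mul_add]
  simp only [fbCoeff]
  rw [two_mul_finsum_even _ _ (hh 0), two_mul_finsum_even _ _ (hh 1)]
  ring

lemma conv_single_right (f : ℤ → ℝ) (k n : ℤ) (c : ℝ) :
    conv f (Pi.single k c) n = f (n - k) * c := by
  rw [conv, finsum_eq_single _ (n - k)]
  · simp
  · intro m hm
    rw [Pi.single_eq_of_ne (by omega), mul_zero]

lemma conv_single_zero_left (x : ℤ → ℝ) (n : ℤ) (c : ℝ) :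
    conv (Pi.single 0 c) x n = c * x n := by
  rw [conv, finsum_eq_single _ 0]
  · simp
  · intro m hm
    rw [Pi.single_eq_of_ne hm, zero_mul]

lemma modSeq_single (k : ℤ) : modSeq (Pi.single k 1) = Pi.single k ((-1 : ℝ) ^ k) := by
  funext n
  rcases eq_or_ne n k with rfl | hn
  · simp [modSeq]
  · simp [modSeq, hn]

lemma isPR_iff_transferFilter {g h : ZMod 2 → ℤ → ℝ}
    (hg : ∀ i : ZMod 2, (Function.support (g i)).Finite)
    (hh : ∀ i : ZMod 2, (Function.support (h i)).Finite) :
    IsPR g h ↔ transferFilter g h = Pi.single 0 2 ∧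
      transferFilter (fun i => modSeq (g i)) h = 0 := by
  constructor
  · intro hPR
    have key : ∀ k n : ℤ, 2 * (Pi.single k 1 : ℤ → ℝ) n = transferFilter g h (n - k)
        + transferFilter (fun i => modSeq (g i)) h (n - k) * (-1) ^ k := by
      intro k n
      rw [hPR (Pi.single k 1) n, two_mul_reconstruction hg hh, modSeq_single,
        conv_single_right, conv_single_right, mul_one]
    have h0 : ∀ n, 2 * (Pi.single 0 1 : ℤ → ℝ) n = transferFilter g h n
        + transferFilter (fun i => modSeq (g i)) h n := fun n => by simpa using key 0 n
    have h1 : ∀ n, 2 * (Pi.single 0 1 : ℤ → ℝ) n = transferFilter g h n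
        - transferFilter (fun i => modSeq (g i)) h n := by
      intro n
      have h2 := key 1 (n + 1)
      have h3 : (Pi.single 1 1 : ℤ → ℝ) (n + 1) = (Pi.single 0 1 : ℤ → ℝ) n := by
        simp [Pi.single_apply]
      rw [h3] at h2
      simpa [sub_eq_add_neg] using h2
    constructor
    · funext n
      have h2 : (Pi.single 0 2 : ℤ → ℝ) n = 2 * (Pi.single 0 1 : ℤ → ℝ) n := by
        simp [Pi.single_apply]
      linarith [h0 n, h1 n]
    · funext n
      simp only [Pi.zero_apply]
      linarith [h0 n, h1 n]
  · rintro ⟨hA, hB⟩ x n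
    have h2 := two_mul_reconstruction hg hh x n
    rw [hA, hB, conv_single_zero_left] at h2
    have h3 : conv 0 (modSeq x) n = 0 := by simp [conv]
    linarith

lemma support_dtft_term_finite {f : ℤ → ℝ} (hf : (Function.support f).Finite) (ω : ℝ) :
    (Function.support fun n : ℤ =>
      (f n : ℂ) * Complex.exp (-(Complex.I * (n : ℂ) * (ω : ℂ)))).Finite :=
  hf.subset fun n hn => by
    have := left_ne_zero_of_mul hn
    simpa using this

lemma dtft_add {f g : ℤ → ℝ} (hf : (Function.support f).Finite)
    (hg : (Function.support g).Finite) (ω : ℝ) :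
    dtft (fun n => f n + g n) ω = dtft f ω + dtft g ω := by
  rw [dtft, dtft, dtft, ← finsum_add_distrib (support_dtft_term_finite hf ω)
    (support_dtft_term_finite hg ω)]
  exact finsum_congr fun n => by push_cast; ring

/-- The convolution theorem for the discrete-time Fourier transform. -/
lemma dtft_conv {f g : ℤ → ℝ} (hf : (Function.support f).Finite)
    (hg : (Function.support g).Finite) (ω : ℝ) :
    dtft (conv f g) ω = dtft f ω * dtft g ω := by
  have h1 : dtft f ω = ∑ m ∈ hf.toFinset,
      (f m : ℂ) * Complex.exp (-(Complex.I * (m : ℂ) * (ω : ℂ))) := by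
    refine finsum_eq_sum_of_support_subset _ fun m hm => ?_
    have := left_ne_zero_of_mul hm
    simpa using this
  have h2 : ∀ m : ℤ, (f m : ℂ) * Complex.exp (-(Complex.I * (m : ℂ) * (ω : ℂ))) * dtft g ω
      = ∑ᶠ n : ℤ, (f m : ℂ) * ((g (n - m) : ℂ) *
        Complex.exp (-(Complex.I * (n : ℂ) * (ω : ℂ)))) := by
    intro m
    rw [dtft, ← finsum_comp_equiv (Equiv.subRight m), mul_finsum]
    refine finsum_congr fun n => ?_
    have : Complex.exp (-(Complex.I * (n : ℂ) * (ω : ℂ)))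
        = Complex.exp (-(Complex.I * (m : ℂ) * (ω : ℂ)))
          * Complex.exp (-(Complex.I * ((n - m : ℤ) : ℂ) * (ω : ℂ))) := by
      rw [← Complex.exp_add]
      congr 1
      push_cast
      ring
    rw [this, Equiv.subRight_apply]
    ring
  rw [h1, Finset.sum_mul]
  simp_rw [h2]
  rw [← finsum_sum_comm]
  · refine finsum_congr fun n => ?_
    rw [conv_eq_sum hf]
    push_cast
    rw [Finset.sum_mul]
    exact Finset.sum_congr rfl fun m _ => by ring
  · intro m _
    refine (support_shift_finite hg m).subset fun n hn => ?_
    have := left_ne_zero_of_mul (right_ne_zero_of_mul hn)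
    simpa using this

lemma dtft_modSeq (f : ℤ → ℝ) (ω : ℝ) : dtft (modSeq f) ω = dtft f (ω - Real.pi) := by
  refine finsum_congr fun n => ?_
  have : Complex.exp (-(Complex.I * (n : ℂ) * ((ω - Real.pi : ℝ) : ℂ)))
      = (-1) ^ n * Complex.exp (-(Complex.I * (n : ℂ) * (ω : ℂ))) := by
    rw [← Complex.exp_pi_mul_I, ← Complex.exp_int_mul, ← Complex.exp_add]
    congr 1
    push_cast
    ring
  rw [this, modSeq]
  push_cast
  ring

lemma dtft_sub_two_pi (f : ℤ → ℝ) (ω : ℝ) : dtft f (ω - Real.pi - Real.pi) = dtft f ω := by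
  rw [← dtft_modSeq, ← dtft_modSeq, modSeq_modSeq]

lemma dtft_single_zero (c : ℝ) (ω : ℝ) : dtft (Pi.single 0 c) ω = c := by
  rw [dtft, finsum_eq_single _ 0]
  · simp
  · intro n hn
    simp [hn]

/-- The character `ω ↦ exp(−inω)` of the additive group of real numbers. -/
def frequencyCharacter (n : ℤ) : Multiplicative ℝ →* ℂ where
  toFun ω := Complex.exp (-(Complex.I * (n : ℂ) * ((Multiplicative.toAdd ω : ℝ) : ℂ)))
  map_one' := by simp
  map_mul' a b := by
    rw [← Complex.exp_add, toAdd_mul]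
    congr 1
    push_cast
    ring

lemma frequencyCharacter_injective : Function.Injective frequencyCharacter := by
  intro n m hnm
  by_contra hne
  have hd : ((n : ℂ) - m) ≠ 0 := sub_ne_zero.2 (by exact_mod_cast hne)
  have h := DFunLike.congr_fun hnm (Multiplicative.ofAdd (Real.pi / ((n : ℝ) - m)))
  simp only [frequencyCharacter, MonoidHom.coe_mk, OneHom.coe_mk, toAdd_ofAdd] at h
  have h2 : Complex.exp (-(Complex.I * (m : ℂ) * ((Real.pi / ((n : ℝ) - m) : ℝ) : ℂ)))
      = -Complex.exp (-(Complex.I * (n : ℂ) * ((Real.pi / ((n : ℝ) - m) : ℝ) : ℂ))) := by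
    rw [← Complex.exp_add_pi_mul_I]
    congr 1
    push_cast
    field_simp
    ring
  rw [← h] at h2
  exact Complex.exp_ne_zero _ (self_eq_neg.1 h2)

/-- A finitely supported sequence is determined by its discrete-time Fourier transform. -/
lemma dtft_injective {f g : ℤ → ℝ} (hf : (Function.support f).Finite)
    (hg : (Function.support g).Finite) (hfg : ∀ ω, dtft f ω = dtft g ω) : f = g := by
  have hli := (linearIndependent_monoidHom (Multiplicative ℝ) ℂ).comp _
    frequencyCharacter_injective
  set s := hf.toFinset ∪ hg.toFinset
  have hsum : ∀ e : ℤ → ℝ, Function.support e ⊆ s → ∀ ω : ℝ, dtft e ω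
      = ∑ n ∈ s, (e n : ℂ) * Complex.exp (-(Complex.I * (n : ℂ) * (ω : ℂ))) := by
    intro e he ω
    refine finsum_eq_sum_of_support_subset _ fun m hm => he ?_
    have := left_ne_zero_of_mul hm
    simpa using this
  have hfs : Function.support f ⊆ s := by simp [s]
  have hgs : Function.support g ⊆ s := by simp [s]
  have hz := linearIndependent_iff'.1 hli s (fun n => (f n : ℂ) - g n) (by
    funext ω
    have h := hfg ω.toAdd
    rw [hsum f hfs, hsum g hgs, ← sub_eq_zero, ← Finset.sum_sub_distrib] at h
    simpa [Finset.sum_apply, frequencyCharacter, sub_mul] using h)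
  funext n
  by_cases hn : n ∈ s
  · exact_mod_cast sub_eq_zero.1 (hz n hn)
  · rw [Function.notMem_support.1 fun h => hn (hfs h),
      Function.notMem_support.1 fun h => hn (hgs h)]

lemma dtft_transferFilter {g h : ZMod 2 → ℤ → ℝ}
    (hg : ∀ i : ZMod 2, (Function.support (g i)).Finite)
    (hh : ∀ i : ZMod 2, (Function.support (h i)).Finite) (ω : ℝ) :
    dtft (transferFilter g h) ω = dtft (g 0) ω * dtft (h 0) ω + dtft (g 1) ω * dtft (h 1) ω := by
  have h1 : dtft (transferFilter g h) ω = dtft (conv (h 0) (g 0)) ω + dtft (conv (h 1) (g 1)) ω :=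
    dtft_add (support_conv_finite (hh 0) (hg 0)) (support_conv_finite (hh 1) (hg 1)) ω
  rw [h1, dtft_conv (hh 0) (hg 0), dtft_conv (hh 1) (hg 1)]
  ring

/-- Alias-cancellation equivalence for perfect reconstruction. -/
theorem alias_cancellation_equivalence (g h : ZMod 2 → ℤ → ℝ)
    (hg : ∀ i : ZMod 2, (Function.support (g i)).Finite)
    (hh : ∀ i : ZMod 2, (Function.support (h i)).Finite) :
    IsPR g h ↔ ∀ ω : ℝ,
      dtft (g 0) ω * dtft (h 0) ω + dtft (g 1) ω * dtft (h 1) ω = 2 ∧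
      dtft (g 0) ω * dtft (h 0) (ω - Real.pi)
        + dtft (g 1) ω * dtft (h 1) (ω - Real.pi) = 0 := by
  have hm : ∀ i : ZMod 2, (Function.support (modSeq (g i))).Finite :=
    fun i => support_modSeq_finite (hg i)
  have hzero : ∀ ω, dtft 0 ω = 0 := fun ω => by simp [dtft]
  have hA := dtft_transferFilter hg hh
  have hB := dtft_transferFilter hm hh
  simp only [dtft_modSeq] at hB
  rw [isPR_iff_transferFilter hg hh]
  constructor
  · rintro ⟨h1, h2⟩ ω
    constructor
    · rw [← hA, h1, dtft_single_zero]
      norm_num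
    · have h3 := hB (ω - Real.pi)
      rw [h2, hzero, dtft_sub_two_pi, dtft_sub_two_pi] at h3
      exact h3.symm
  · intro H
    constructor
    · refine dtft_injective (support_transferFilter_finite hg hh)
        ((Set.finite_singleton 0).subset Pi.support_single_subset) fun ω => ?_
      rw [hA, (H ω).1, dtft_single_zero]
      norm_num
    · refine dtft_injective (support_transferFilter_finite hm hh) (by simp) fun ω => ?_
      have h3 := (H (ω - Real.pi)).2
      rw [dtft_sub_two_pi, dtft_sub_two_pi] at h3
      rw [hB, h3, hzero]
end
end

section
/- Let {g_i, h_i}_{i∈{0,1}} be a perfect reconstruction filterbank with finitely supported filters. Then there exist a ∈ ℝ with a ≠ 0 and b ∈ ℤ such that for all ω ∈ ℝ and i ∈ {0,1}: ĝ_i(ω) = (−1)^{1−i}·a·exp(i(2b+1)ω)·ĥ_{1−i}(ω−π). -/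
open scoped BigOperators

noncomputable section

open LaurentPolynomial

/-- A unit of the ring of Laurent polynomials over a field is a monomial. -/
lemma LaurentPolynomial.exists_eq_C_mul_T_of_isUnit {K : Type*} [Field K] {p : K[T;T⁻¹]}
    (hp : IsUnit p) : ∃ (c : K) (k : ℤ), c ≠ 0 ∧ p = C c * T k := by
  obtain ⟨q, hpq⟩ := hp.exists_right_inv
  obtain ⟨n, P, hP⟩ := exists_T_pow p
  obtain ⟨m, Q, hQ⟩ := exists_T_pow q
  have hPQ : P * Q = Polynomial.X ^ (n + m) := by
    apply Polynomial.toLaurent_injective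
    rw [map_mul, hP, hQ, Polynomial.toLaurent_X_pow]
    push_cast
    rw [T_add]
    linear_combination (T (n : ℤ) * T (m : ℤ)) * hpq
  obtain ⟨j, -, hj⟩ := (dvd_prime_pow Polynomial.prime_X _).1 (Dvd.intro _ hPQ)
  obtain ⟨u, hu⟩ := hj.symm
  obtain ⟨c, hc, hcu⟩ := Polynomial.isUnit_iff.1 u.isUnit
  refine ⟨c, j - n, hc.ne_zero, ?_⟩
  have h1 : p * T n = C c * T j := by
    rw [← hP, ← hu, ← hcu, map_mul, Polynomial.toLaurent_X_pow, Polynomial.toLaurent_C, mul_comm]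
  calc p = p * T n * T (-n) := by rw [mul_T_assoc]; simp
    _ = C c * T (j - n) := by rw [h1, mul_T_assoc, sub_eq_add_neg]

/-- The substitution `T ↦ -T` on real Laurent polynomials. -/
def negArg : ℝ[T;T⁻¹] →+* ℝ[T;T⁻¹] :=
  eval₂ C (-(isUnit_T (R := ℝ) 1).unit)

lemma negArg_C_mul_T (r : ℝ) (n : ℤ) : negArg (C r * T n) = C ((-1) ^ n * r) * T n := by
  have hT : (((isUnit_T (R := ℝ) 1).unit ^ n : (ℝ[T;T⁻¹])ˣ) : ℝ[T;T⁻¹]) = T n := by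
    rcases Int.eq_nat_or_neg n with ⟨m, rfl | rfl⟩
    · rw [zpow_natCast, Units.val_pow_eq_pow_val, IsUnit.unit_spec, T_pow, mul_one]
    · rw [zpow_neg, zpow_natCast, Units.inv_eq_of_mul_eq_one_right]
      rw [Units.val_pow_eq_pow_val, IsUnit.unit_spec, T_pow, mul_one, ← T_add, add_neg_cancel,
        T_zero]
  rw [negArg, eval₂_C_mul_T, neg_eq_neg_one_mul, mul_zpow, Units.val_mul, hT]
  rcases Int.even_or_odd n with h | h
  · simp [h.neg_one_zpow]
  · simp [h.neg_one_zpow]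

lemma coeff_negArg (p : ℝ[T;T⁻¹]) (n : ℤ) : (negArg p).coeff n = (-1) ^ n * p.coeff n := by
  induction p using LaurentPolynomial.induction_on' with
  | add p q hp hq => simp [hp, hq, mul_add]
  | C_mul_T m a =>
    rw [negArg_C_mul_T, ← single_eq_C_mul_T, ← single_eq_C_mul_T]
    by_cases h : m = n
    · subst h; simp [-single_eq_C_mul_T]
    · simp [-single_eq_C_mul_T, h]

lemma negArg_negArg (p : ℝ[T;T⁻¹]) : negArg (negArg p) = p := by
  ext n
  rw [coeff_negArg, coeff_negArg, ← mul_assoc, ← mul_zpow]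
  simp

/-- The `z`-transform, in the variable `T = z⁻¹`, of a finitely supported sequence. -/
def zTransform (f : ℤ → ℝ) (hf : (Function.support f).Finite) : ℝ[T;T⁻¹] :=
  .ofCoeff (Finsupp.ofSupportFinite f hf)

@[simp]
lemma coeff_zTransform (f : ℤ → ℝ) (hf : (Function.support f).Finite) (n : ℤ) :
    (zTransform f hf).coeff n = f n := rfl

lemma zTransform_eq_sum (f : ℤ → ℝ) (hf : (Function.support f).Finite) :
    zTransform f hf = ∑ n ∈ hf.toFinset, C (f n) * T n := by
  ext n
  simp_rw [← single_eq_C_mul_T]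
  rw [AddMonoidAlgebra.coeff_sum, Finset.sum_apply']
  simp [-single_eq_C_mul_T, Finsupp.single_apply]

lemma coeff_mul_zTransform (p : ℝ[T;T⁻¹]) (f : ℤ → ℝ) (hf : (Function.support f).Finite) (n : ℤ) :
    (p * zTransform f hf).coeff n = ∑ᶠ m, p.coeff (n - m) * f m := by
  rw [zTransform_eq_sum, Finset.mul_sum, AddMonoidAlgebra.coeff_sum, Finset.sum_apply',
    finsum_eq_sum_of_support_subset (s := hf.toFinset)]
  · refine Finset.sum_congr rfl fun m _ => ?_
    rw [← single_eq_C_mul_T]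
    simp [-single_eq_C_mul_T, sub_eq_add_neg, AddMonoidAlgebra.coeff_mul_single_apply]
  · intro m hm
    simp only [Function.mem_support] at hm
    simpa using right_ne_zero_of_mul hm

/-- The unit `exp (-iω)` of `ℂ`. -/
def expUnit (ω : ℝ) : ℂˣ := Units.mk0 (Complex.exp (-(Complex.I * ω))) (Complex.exp_ne_zero _)

lemma expUnit_zpow (ω : ℝ) (n : ℤ) :
    ((expUnit ω ^ n : ℂˣ) : ℂ) = Complex.exp (-(Complex.I * n * ω)) := by
  rw [Units.val_zpow_eq_zpow_val, expUnit, Units.val_mk0, ← Complex.exp_int_mul]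
  congr 1
  ring

lemma expUnit_sub_pi (ω : ℝ) : expUnit (ω - Real.pi) = -expUnit ω := by
  ext
  simp only [expUnit, Units.val_mk0, Units.val_neg, Complex.ofReal_sub]
  rw [mul_sub, neg_sub, sub_eq_neg_add, Complex.exp_add, mul_comm Complex.I (Real.pi : ℂ),
    Complex.exp_pi_mul_I]
  ring

lemma eval₂_negArg (z : ℂˣ) (p : ℝ[T;T⁻¹]) :
    eval₂ Complex.ofRealHom z (negArg p) = eval₂ Complex.ofRealHom (-z) p := by
  induction p using LaurentPolynomial.induction_on' with
  | add p q hp hq => simp [hp, hq]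
  | C_mul_T m a =>
    rw [negArg_C_mul_T, eval₂_C_mul_T, eval₂_C_mul_T, neg_eq_neg_one_mul z, mul_zpow]
    rcases Int.even_or_odd m with h | h
    · simp [h.neg_one_zpow]
    · simp [h.neg_one_zpow]

lemma dtft_eq_eval₂ (f : ℤ → ℝ) (hf : (Function.support f).Finite) (ω : ℝ) :
    dtft f ω = eval₂ Complex.ofRealHom (expUnit ω) (zTransform f hf) := by
  rw [zTransform_eq_sum, map_sum, dtft, finsum_eq_sum_of_support_subset (s := hf.toFinset)]
  · simp only [eval₂_C_mul_T, expUnit_zpow, Complex.ofRealHom_eq_coe]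
  · intro m hm
    simp only [Function.mem_support] at hm
    simpa using left_ne_zero_of_mul hm

/-- The perfect reconstruction property, tested on unit impulses. -/
lemma IsPR.sum_eq_ite {g h : ZMod 2 → ℤ → ℝ} (hPR : IsPR g h) (k n : ℤ) :
    ∑ i : ZMod 2, ∑ᶠ m : ℤ, h i (n - 2 * m) * g i (2 * m - k) = if n = k then 1 else 0 := by
  have hδ : ∀ (f : ℤ → ℝ) (m : ℤ),
      fbCoeff f (fun j => if j = k then 1 else 0) m = f (2 * m - k) := by
    intro f m
    rw [fbCoeff, conv, finsum_eq_single _ (2 * m - k)]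
    · simp
    · intro j hj
      rw [if_neg (by omega), mul_zero]
  simpa only [hδ] using (hPR (fun j => if j = k then 1 else 0) n).symm

/-- The subsequence of `f` supported on the indices congruent to `k` modulo `2`. -/
def phase (k : ℤ) (f : ℤ → ℝ) (n : ℤ) : ℝ := if Even (n + k) then f n else 0

lemma support_phase_finite (k : ℤ) {f : ℤ → ℝ} (hf : (Function.support f).Finite) :
    (Function.support (phase k f)).Finite := by
  refine hf.subset fun n hn => ?_
  simp only [phase, Function.mem_support, ne_eq, ite_eq_right_iff, not_forall] at hn
  exact hn.2

lemma finsum_mul_phase (u f : ℤ → ℝ) (k : ℤ) :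
    ∑ᶠ j, u j * phase k f j = ∑ᶠ m, u (2 * m - k) * f (2 * m - k) := by
  have hinj : Function.Injective fun m : ℤ => 2 * m - k := fun a b hab => by
    simp only at hab; omega
  rw [← finsum_mem_range (f := fun j => u j * f j) hinj]
  refine finsum_congr fun j => ?_
  classical
  rw [finsum_eq_if, phase]
  have : j ∈ Set.range (fun m : ℤ => 2 * m - k) ↔ Even (j + k) := by
    constructor
    · rintro ⟨m, rfl⟩
      exact ⟨m, by ring⟩
    · rintro ⟨m, hm⟩
      exact ⟨m, by simp only; omega⟩
  by_cases hj : Even (j + k)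
  · rw [if_pos hj, if_pos (this.2 hj)]
  · rw [if_neg hj, if_neg (mt this.1 hj), mul_zero]

lemma IsPR.sum_zTransform_mul_phase {g h : ZMod 2 → ℤ → ℝ} (hPR : IsPR g h)
    (hg : ∀ i, (Function.support (g i)).Finite) (hh : ∀ i, (Function.support (h i)).Finite)
    (k : ℤ) :
    ∑ i, zTransform (h i) (hh i) * zTransform (phase k (g i)) (support_phase_finite k (hg i))
      = 1 := by
  ext n
  rw [AddMonoidAlgebra.coeff_sum, Finset.sum_apply']
  simp only [coeff_mul_zTransform, coeff_zTransform]
  have := hPR.sum_eq_ite k (n + k)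
  rw [← T_zero, T_apply]
  convert this using 1
  · refine Finset.sum_congr rfl fun i _ => ?_
    rw [finsum_mul_phase (fun j => h i (n - j))]
    refine finsum_congr fun m => ?_
    congr 2
    ring
  · congr 1
    simp [eq_comm]

lemma zTransform_eq_phase_add_phase (f : ℤ → ℝ) (hf : (Function.support f).Finite) :
    zTransform f hf = zTransform (phase 0 f) (support_phase_finite 0 hf)
      + zTransform (phase 1 f) (support_phase_finite 1 hf) := by
  ext n
  rcases Int.even_or_odd n with h | h <;> simp [phase, h]

lemma negArg_zTransform_phase_zero (f : ℤ → ℝ) (hf : (Function.support (phase 0 f)).Finite) :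
    negArg (zTransform (phase 0 f) hf) = zTransform (phase 0 f) hf := by
  ext n
  rcases Int.even_or_odd n with h | h
  · simp [coeff_negArg, h.neg_one_zpow]
  · simp [coeff_negArg, phase, Int.not_even_iff_odd.2 h]

lemma negArg_zTransform_phase_one (f : ℤ → ℝ) (hf : (Function.support (phase 1 f)).Finite) :
    negArg (zTransform (phase 1 f) hf) = -zTransform (phase 1 f) hf := by
  ext n
  rcases Int.even_or_odd n with h | h
  · simp [coeff_negArg, phase, Int.not_odd_iff_even.2 h]
  · simp [coeff_negArg, h.neg_one_zpow]

/-- The perfect reconstruction conditions in the `z`-domain determine the analysis filters from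
the synthesis filters, up to a monomial of odd degree. -/
lemma exists_eq_monomial_mul_negArg {G₀ G₁ H₀ H₁ : ℝ[T;T⁻¹]} (h2 : H₀ * G₀ + H₁ * G₁ = 2)
    (h0 : H₀ * negArg G₀ + H₁ * negArg G₁ = 0) :
    ∃ (a : ℝ) (b : ℤ), a ≠ 0 ∧ G₀ = C (-a) * T (-(2 * b + 1)) * negArg H₁ ∧
      G₁ = C a * T (-(2 * b + 1)) * negArg H₀ := by
  have h2' : negArg H₀ * negArg G₀ + negArg H₁ * negArg G₁ = 2 := by
    simpa only [map_add, map_mul, map_ofNat] using congrArg negArg h2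
  have h0' : negArg H₀ * G₀ + negArg H₁ * G₁ = 0 := by
    simpa [negArg_negArg] using congrArg negArg h0
  set D := H₀ * negArg H₁ - H₁ * negArg H₀ with hD
  have hC : (C 2⁻¹ : ℝ[T;T⁻¹]) * 2 = 1 := by
    rw [← map_ofNat C 2, ← map_mul]
    norm_num
  have hunit : IsUnit D := by
    refine IsUnit.of_mul_eq_one (C 2⁻¹ * C 2⁻¹ * (G₀ * negArg G₁ - G₁ * negArg G₀)) ?_
    have h4 : D * (G₀ * negArg G₁ - G₁ * negArg G₀) = 2 * 2 := by
      rw [hD]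
      linear_combination (negArg H₀ * negArg G₀ + negArg H₁ * negArg G₁) * h2 + 2 * h2'
        - (negArg H₀ * G₀ + negArg H₁ * G₁) * h0
    linear_combination C 2⁻¹ * C 2⁻¹ * h4 + (C 2⁻¹ * 2 + 1) * hC
  obtain ⟨c, k, hc, hDk⟩ := exists_eq_C_mul_T_of_isUnit hunit
  have hodd : negArg D = -D := by
    simp only [hD, map_sub, map_mul, negArg_negArg]
    ring
  have hk : Odd k := by
    by_contra hk
    rw [Int.not_odd_iff_even] at hk
    rw [hDk, negArg_C_mul_T, hk.neg_one_zpow, one_mul, ← single_eq_C_mul_T] at hodd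
    have := congrArg (fun p : ℝ[T;T⁻¹] => p.coeff k) hodd
    simp [-single_eq_C_mul_T] at this
    exact hc (by linarith)
  obtain ⟨b, rfl⟩ := hk
  have hinv : C c⁻¹ * T (-(2 * b + 1)) * D = 1 := by
    rw [hDk]
    calc _ = (C c⁻¹ * C c) * (T (-(2 * b + 1)) * T (2 * b + 1) : ℝ[T;T⁻¹]) := by ring
      _ = 1 := by rw [← map_mul, ← T_add, inv_mul_cancel₀ hc]; simp
  refine ⟨-2 * c⁻¹, b, by simpa using hc, ?_, ?_⟩
  · have : D * G₀ = 2 * negArg H₁ := by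
      rw [hD]
      linear_combination negArg H₁ * h2 - H₁ * h0'
    simp only [neg_mul, neg_neg, map_mul, map_ofNat]
    linear_combination C c⁻¹ * T (-(2 * b + 1)) * this - G₀ * hinv
  · have : D * G₁ = -2 * negArg H₀ := by
      rw [hD]
      linear_combination H₀ * h0' - negArg H₀ * h2
    simp only [neg_mul, map_neg, map_mul, map_ofNat]
    linear_combination C c⁻¹ * T (-(2 * b + 1)) * this - G₁ * hinv

/-- Analysis–synthesis symmetry of perfect reconstruction filterbanks. -/
theorem analysis_synthesis_symmetry (g h : ZMod 2 → ℤ → ℝ)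
    (hg : ∀ i : ZMod 2, (Function.support (g i)).Finite)
    (hh : ∀ i : ZMod 2, (Function.support (h i)).Finite)
    (hPR : IsPR g h) :
    ∃ a : ℝ, a ≠ 0 ∧ ∃ b : ℤ, SymmAS g h a b := by
  have huniv : ∀ F : ZMod 2 → ℝ[T;T⁻¹], ∑ i, F i = F 0 + F 1 := fun F => Fin.sum_univ_two F
  have he := hPR.sum_zTransform_mul_phase hg hh 0
  have ho := hPR.sum_zTransform_mul_phase hg hh 1
  rw [huniv] at he ho
  obtain ⟨a, b, ha, hG₀, hG₁⟩ := exists_eq_monomial_mul_negArg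
    (G₀ := zTransform (g 0) (hg 0)) (G₁ := zTransform (g 1) (hg 1))
    (H₀ := zTransform (h 0) (hh 0)) (H₁ := zTransform (h 1) (hh 1))
    (by
      rw [zTransform_eq_phase_add_phase (g 0), zTransform_eq_phase_add_phase (g 1)]
      linear_combination he + ho)
    (by
      rw [zTransform_eq_phase_add_phase (g 0), zTransform_eq_phase_add_phase (g 1)]
      simp only [map_add, negArg_zTransform_phase_zero, negArg_zTransform_phase_one]
      linear_combination he - ho)
  refine ⟨a, ha, b, fun i ω => ?_⟩
  have hexp : ((expUnit ω ^ (-(2 * b + 1)) : ℂˣ) : ℂ)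
      = Complex.exp (Complex.I * (2 * (b : ℂ) + 1) * (ω : ℂ)) := by
    rw [expUnit_zpow]
    congr 1
    push_cast
    ring
  have hi : i = 0 ∨ i = 1 := by revert i; decide
  rcases hi with rfl | rfl
  · have hval : (1 - 0 : ZMod 2).val = 1 := rfl
    rw [hval, sub_zero, dtft_eq_eval₂ _ (hg 0), dtft_eq_eval₂ _ (hh 1), hG₀, map_mul, eval₂_negArg,
      eval₂_C_mul_T, hexp, expUnit_sub_pi]
    simp
  · have hval : (1 - 1 : ZMod 2).val = 0 := rfl
    rw [hval, sub_self, dtft_eq_eval₂ _ (hg 1), dtft_eq_eval₂ _ (hh 0), hG₁, map_mul, eval₂_negArg,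
      eval₂_C_mul_T, hexp, expUnit_sub_pi]
    simp
end
end

section
/- Let {g_i, h_i}_{i∈{0,1}} be a perfect reconstruction filterbank with finitely supported filters that satisfies the analysis–synthesis symmetry with parameters (a,b). Then the complementary filterbank {g̃_i, h̃_i}_{i∈{0,1}} is also a perfect reconstruction filterbank. -/
open scoped BigOperators

noncomputable section

theorem conv_eq_finsum_sub (f x : ℤ → ℝ) (n : ℤ) : conv f x n = ∑ᶠ j : ℤ, f (n - j) * x j := by
  rw [conv, ← finsum_comp_equiv (Equiv.subLeft n)]
  simp

/-- Perfect reconstruction of the unit impulses. -/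
theorem IsPR.kernel_eq {g h : ZMod 2 → ℤ → ℝ} (hPR : IsPR g h) (n k : ℤ) :
    ∑ i : ZMod 2, ∑ᶠ m : ℤ, h i (n - 2 * m) * g i (2 * m - k) = if n = k then 1 else 0 := by
  have hconv (i : ZMod 2) (m : ℤ) :
      fbCoeff (g i) (fun j => if j = k then 1 else 0) m = g i (2 * m - k) := by
    rw [fbCoeff, conv_eq_finsum_sub, finsum_eq_single _ k (by simp +contextual)]
    simp
  have := hPR (fun j => if j = k then 1 else 0) n
  simp only [hconv] at this
  exact this.symm

/-- A filterbank with finitely supported filters that reconstructs the unit impulses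
reconstructs every sequence. -/
theorem isPR_of_kernel_eq {g h : ZMod 2 → ℤ → ℝ}
    (hg : ∀ i, (Function.support (g i)).Finite) (hh : ∀ i, (Function.support (h i)).Finite)
    (hker : ∀ n k : ℤ, ∑ i : ZMod 2, ∑ᶠ m : ℤ, h i (n - 2 * m) * g i (2 * m - k) =
      if n = k then 1 else 0) :
    IsPR g h := by
  intro x n
  obtain ⟨A, hA⟩ : ∃ A : Finset ℤ, ∀ i m, h i (n - 2 * m) ≠ 0 → m ∈ A := by
    have hfin : (⋃ i, (fun m : ℤ => n - 2 * m) ⁻¹' Function.support (h i)).Finite :=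
      Set.finite_iUnion fun i => (hh i).preimage fun p _ q _ hpq => by
        have : n - 2 * p = n - 2 * q := hpq
        omega
    exact ⟨hfin.toFinset, fun i m hm => hfin.mem_toFinset.2 (Set.mem_iUnion.2 ⟨i, hm⟩)⟩
  obtain ⟨B, hB⟩ : ∃ B : Finset ℤ, ∀ i, ∀ m ∈ A, ∀ j, g i (2 * m - j) ≠ 0 → j ∈ B := by
    have hfin : (⋃ m ∈ A, ⋃ i, (fun j : ℤ => 2 * m - j) ⁻¹' Function.support (g i)).Finite :=
      A.finite_toSet.biUnion fun m _ => Set.finite_iUnion fun i =>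
        (hg i).preimage sub_right_injective.injOn
    exact ⟨hfin.toFinset, fun i m hm j hj =>
      hfin.mem_toFinset.2 (Set.mem_biUnion hm (Set.mem_iUnion.2 ⟨i, hj⟩))⟩
  have hsumA (i : ZMod 2) (f : ℤ → ℝ) :
      ∑ᶠ m, h i (n - 2 * m) * f m = ∑ m ∈ A, h i (n - 2 * m) * f m :=
    finsum_eq_sum_of_support_subset _ fun m hm => hA i m (left_ne_zero_of_mul hm)
  have hsumB (i : ZMod 2) (m : ℤ) (hm : m ∈ A) :
      fbCoeff (g i) x m = ∑ j ∈ insert n B, g i (2 * m - j) * x j := by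
    rw [fbCoeff, conv_eq_finsum_sub]
    exact finsum_eq_sum_of_support_subset _ fun j hj =>
      Finset.mem_insert_of_mem (hB i m hm j (left_ne_zero_of_mul hj))
  simp only [hsumA]
  symm
  calc ∑ i, ∑ m ∈ A, h i (n - 2 * m) * fbCoeff (g i) x m
      = ∑ i, ∑ m ∈ A, ∑ j ∈ insert n B, h i (n - 2 * m) * g i (2 * m - j) * x j := by
        refine Finset.sum_congr rfl fun i _ => Finset.sum_congr rfl fun m hm => ?_
        rw [hsumB i m hm, Finset.mul_sum]
        simp only [mul_assoc]
    _ = ∑ j ∈ insert n B, (∑ i, ∑ m ∈ A, h i (n - 2 * m) * g i (2 * m - j)) * x j := by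
        simp only [Finset.sum_mul]
        rw [Finset.sum_comm (s := insert n B)]
        exact Finset.sum_congr rfl fun i _ => Finset.sum_comm
    _ = x n := by
        simp only [← hsumA, hker]
        simp

/-- The complementary filterbank of a PR filterbank is also PR. -/
theorem complementary_is_PR (g h : ZMod 2 → ℤ → ℝ)
    (hg : ∀ i : ZMod 2, (Function.support (g i)).Finite)
    (hh : ∀ i : ZMod 2, (Function.support (h i)).Finite)
    (a : ℝ) (b : ℤ) (ha : a ≠ 0)
    (hPR : IsPR g h) (hsym : SymmAS g h a b) :
    IsPR (fun i => compG a b (h i)) (fun i => compH a b (g i)) := by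
  have hfin {c : ℝ} {f : ℤ → ℝ} (k : ℤ) (hf : (Function.support f).Finite) :
      (Function.support fun n => c * f (n + k)).Finite :=
    (hf.preimage (add_left_injective k).injOn).subset fun _ hn => right_ne_zero_of_mul hn
  refine isPR_of_kernel_eq (fun i => hfin _ (hh i)) (fun i => hfin (-(2 * b + 1)) (hg i))
    fun n k => ?_
  -- After `m ↦ -m`, this is the original kernel transposed and reversed in time.
  have hker := hPR.kernel_eq (2 * b + 1 - k) (2 * b + 1 - n)
  simp only [sub_right_inj, eq_comm (a := k)] at hker
  rw [← hker]
  refine Finset.sum_congr rfl fun i _ => ?_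
  rw [← finsum_comp_equiv (Equiv.neg ℤ)]
  refine finsum_congr fun m => ?_
  simp only [compG, compH, Equiv.neg_apply]
  rw [show n - 2 * -m - (2 * b + 1) = 2 * m - (2 * b + 1 - n) by ring,
    show 2 * -m - k + (2 * b + 1) = 2 * b + 1 - k - 2 * m by ring]
  field_simp
end
end

section
/- (Reverse-Order Subband Structure) Let {g_i, h_i}_{i∈{0,1}} be a perfect reconstruction filterbank with finitely supported filters that satisfies the analysis–synthesis symmetry with parameters (a,b). Then for every x : ℤ → ℝ, i ∈ {0,1}, and n ∈ ℤ: v^{x_m}_i[n] = (−1)^i·w^x_{1−i}[n]. -/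
open scoped BigOperators

noncomputable section

/-- The characters `ω ↦ exp(−i·n·ω)` of the additive group of reals. -/
def expChar (n : ℤ) : Multiplicative ℝ →* ℂ where
  toFun ω := Complex.exp (-(Complex.I * (n : ℂ) * (ω.toAdd : ℂ)))
  map_one' := by simp
  map_mul' x y := by
    rw [← Complex.exp_add, toAdd_mul]
    push_cast
    ring_nf

theorem expChar_injective : Function.Injective expChar := by
  intro m n hmn
  by_contra hne
  have hd : (n : ℂ) - m ≠ 0 := sub_ne_zero.2 fun h => hne (by exact_mod_cast h.symm)
  have key := DFunLike.congr_fun hmn (Multiplicative.ofAdd (Real.pi / ((n : ℝ) - m)))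
  simp only [expChar, MonoidHom.coe_mk, OneHom.coe_mk, toAdd_ofAdd] at key
  have h1 : -(Complex.I * (m : ℂ) * ((Real.pi / ((n : ℝ) - m) : ℝ) : ℂ))
      = -(Complex.I * (n : ℂ) * ((Real.pi / ((n : ℝ) - m) : ℝ) : ℂ)) + Real.pi * Complex.I := by
    push_cast
    field_simp
    ring
  rw [h1, Complex.exp_add, Complex.exp_pi_mul_I] at key
  have hz := Complex.exp_ne_zero (-(Complex.I * (n : ℂ) * ((Real.pi / ((n : ℝ) - m) : ℝ) : ℂ)))
  apply hz
  linear_combination (-1 / 2 : ℂ) * key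

theorem dtft_eq_sum {f : ℤ → ℝ} {s : Finset ℤ} (hs : Function.support f ⊆ s) (ω : ℝ) :
    dtft f ω = ∑ n ∈ s, (f n : ℂ) * expChar n (Multiplicative.ofAdd ω) := by
  refine finsum_eq_sum_of_support_subset _ fun n hn => hs fun h0 => hn ?_
  simp [h0]

theorem dtft_injOn_finite_support {f f' : ℤ → ℝ} (hf : (Function.support f).Finite)
    (hf' : (Function.support f').Finite) (hff' : ∀ ω, dtft f ω = dtft f' ω) : f = f' := by
  classical
  have hli := (linearIndependent_monoidHom (Multiplicative ℝ) ℂ).comp expChar expChar_injective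
  rw [linearIndependent_iff'] at hli
  set s := hf.toFinset ∪ hf'.toFinset with hs
  have hsf : Function.support f ⊆ s := by simp [hs]
  have hsf' : Function.support f' ⊆ s := by simp [hs]
  have hzero := hli s (fun n => (f n : ℂ) - f' n) (by
    ext ω
    have := hff' ω.toAdd
    rw [dtft_eq_sum hsf, dtft_eq_sum hsf'] at this
    simpa [sub_mul, Finset.sum_sub_distrib, sub_eq_zero] using this)
  funext n
  by_cases hn : n ∈ s
  · exact_mod_cast sub_eq_zero.1 (hzero n hn)
  · rw [Function.notMem_support.1 fun h => hn (hsf h),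
      Function.notMem_support.1 fun h => hn (hsf' h)]

theorem dtft_modSeq_shift (f : ℤ → ℝ) (c : ℝ) (k : ℤ) (ω : ℝ) :
    dtft (fun n => c * modSeq (fun m => f (m + k)) n) ω
      = c * (-1 : ℂ) ^ k * Complex.exp (Complex.I * k * ω) * dtft f (ω - Real.pi) := by
  unfold dtft
  rw [← smul_eq_mul, smul_finsum]
  conv_rhs => rw [← finsum_comp_equiv (Equiv.addRight k)]
  refine finsum_congr fun n => ?_
  have hpi : ∀ j : ℤ, (-1 : ℂ) ^ j = Complex.exp (j * (Real.pi * Complex.I)) := fun j => by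
    rw [Complex.exp_int_mul, Complex.exp_pi_mul_I]
  have hexp : (-1 : ℂ) ^ n * Complex.exp (-(Complex.I * n * ω))
      = (-1 : ℂ) ^ k * Complex.exp (Complex.I * k * ω)
        * Complex.exp (-(Complex.I * ((n + k : ℤ) : ℂ) * ((ω - Real.pi : ℝ) : ℂ))) := by
    have hk : (-1 : ℂ) ^ k = (-1 : ℂ) ^ (-k) := by
      rw [zpow_neg, ← inv_zpow]
      norm_num
    rw [hk, hpi, hpi, ← Complex.exp_add, ← Complex.exp_add, ← Complex.exp_add]
    push_cast
    ring_nf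
  simp only [modSeq, Equiv.coe_addRight, smul_eq_mul]
  push_cast at hexp ⊢
  linear_combination (c : ℂ) * f (n + k) * hexp

/-- Time-domain form of the analysis–synthesis symmetry. -/
theorem SymmAS.eq_modSeq_compG {g h : ZMod 2 → ℤ → ℝ} {a : ℝ} {b : ℤ} (hsym : SymmAS g h a b)
    (hg : ∀ i : ZMod 2, (Function.support (g i)).Finite)
    (hh : ∀ i : ZMod 2, (Function.support (h i)).Finite) (i : ZMod 2) (n : ℤ) :
    g i n = (-1 : ℝ) ^ i.val * modSeq (compG a b (h (1 - i))) n := by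
  have hfin : (Function.support fun n =>
      ((-1 : ℝ) ^ i.val * a) * modSeq (fun m => h (1 - i) (m + (2 * b + 1))) n).Finite := by
    refine ((hh (1 - i)).preimage (add_left_injective (2 * b + 1)).injOn).subset fun m hm h0 => hm ?_
    simp [modSeq, h0]
  have hsign : (-1 : ℂ) ^ (1 - i : ZMod 2).val = -(-1 : ℂ) ^ i.val := by
    fin_cases i
    · change (-1 : ℂ) ^ 1 = -(-1 : ℂ) ^ 0
      norm_num
    · change (-1 : ℂ) ^ 0 = -(-1 : ℂ) ^ 1
      norm_num
  have hodd : (-1 : ℂ) ^ (2 * b + 1) = -1 := Odd.neg_one_zpow ⟨b, rfl⟩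
  have heq := dtft_injOn_finite_support (hg i) hfin fun ω => by
    rw [hsym i ω, dtft_modSeq_shift, hsign, hodd]
    push_cast
    ring
  rw [congrFun heq n]
  simp only [modSeq, compG]
  ring

/-- Reverse-Order Subband Structure (ROSS). -/
theorem reverse_order_subband_structure (g h : ZMod 2 → ℤ → ℝ)
    (hg : ∀ i : ZMod 2, (Function.support (g i)).Finite)
    (hh : ∀ i : ZMod 2, (Function.support (h i)).Finite)
    (a : ℝ) (b : ℤ) (ha : a ≠ 0)
    (hPR : IsPR g h) (hsym : SymmAS g h a b)
    (x : ℤ → ℝ) (i : ZMod 2) (n : ℤ) :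
    fbCoeff (g i) (modSeq x) n
      = (-1 : ℝ) ^ i.val * fbCoeff (compG a b (h (1 - i))) x n := by
  unfold fbCoeff conv
  rw [← smul_eq_mul (_ ^ _), smul_finsum]
  refine finsum_congr fun m => ?_
  have hsq : (-1 : ℝ) ^ m * (-1 : ℝ) ^ (2 * n - m) = 1 := by
    rw [← zpow_add₀ (by norm_num), add_sub_cancel]
    exact Even.neg_one_zpow (even_two_mul n)
  rw [hsym.eq_modSeq_compG hg hh i m, smul_eq_mul]
  simp only [modSeq]
  linear_combination
    (-1 : ℝ) ^ i.val * compG a b (h (1 - i)) m * x (2 * n - m) * hsq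
end
end

section
/- (Multi-Level Self-Complementary ROSS, part a) Let {g_i, h_i}_{i∈{0,1}} be a perfect reconstruction filterbank with finitely supported filters that satisfies the analysis–synthesis symmetry with parameters (a,b) and is self-complementary. Then for every number of levels L ≥ 1, every bit vector 𝐢 ∈ {0,1}^L with level-0 bit i_0, every x : ℤ → ℝ, and every n ∈ ℤ: v^x_𝐢[n] = (−1)^{1−i_0}·w^x_𝐢[n]. -/
open scoped BigOperators

noncomputable section

lemma fbCoeff_const_mul (g : ℤ → ℝ) (c : ℝ) (x : ℤ → ℝ) :
    fbCoeff g (fun n => c * x n) = fun n => c * fbCoeff g x n := by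
  funext n
  simp only [fbCoeff, conv, ← smul_eq_mul (a := c), smul_finsum, mul_smul_comm]

lemma mCoeff_const_mul (g : ZMod 2 → ℤ → ℝ) (c : ℝ) (L : ℕ) (i : Fin L → ZMod 2)
    (x : ℤ → ℝ) :
    mCoeff g L i (fun n => c * x n) = fun n => c * mCoeff g L i x n := by
  induction L generalizing x with
  | zero => rfl
  | succ L ih => simp only [mCoeff, fbCoeff_const_mul, ih]

/-- Multi-level self-complementary ROSS (part a). -/
theorem multilevel_selfcomp_ROSS_a (g h : ZMod 2 → ℤ → ℝ)
    (hg : ∀ i : ZMod 2, (Function.support (g i)).Finite)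
    (hh : ∀ i : ZMod 2, (Function.support (h i)).Finite)
    (a : ℝ) (b : ℤ) (ha : a ≠ 0)
    (hPR : IsPR g h) (hsym : SymmAS g h a b)
    (hsc : ∀ (x : ℤ → ℝ) (i : ZMod 2) (n : ℤ),
      fbCoeff (g i) x n
        = (-1 : ℝ) ^ (1 - i : ZMod 2).val * fbCoeff (compG a b (h i)) x n)
    (L : ℕ) (i : Fin (L + 1) → ZMod 2) (x : ℤ → ℝ) (n : ℤ) :
    mCoeff g (L + 1) i x n
      = (-1 : ℝ) ^ (1 - i 0 : ZMod 2).val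
        * mCoeffW g (fun k => compG a b (h k)) (L + 1) i x n := by
  have key := funext (hsc x (i 0))
  simp only [mCoeff, mCoeffW]
  rw [key, mCoeff_const_mul]
end
end

section
/- (Subband Convolution) Let L ≥ 1 and let v^x_𝐢 denote the L-level Haar filterbank coefficients, with subbands indexed by 𝐢 ∈ (ℤ/2ℤ)^L. Then for all x, y : ℤ → ℝ, all 𝐢 ∈ (ℤ/2ℤ)^L, and all n ∈ ℤ, the coefficients of the pointwise product x·y satisfy v^{x·y}_𝐢[n] = 2^{−L}·Σ_{𝐣∈(ℤ/2ℤ)^L} v^x_{𝐢+𝐣}[n]·v^y_𝐣[n], where 𝐢+𝐣 denotes componentwise addition mod 2. -/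
open scoped BigOperators

noncomputable section

theorem conv_haarG (i : ZMod 2) (x : ℤ → ℝ) (n : ℤ) :
    conv (haarG i) x n = x n + (-1 : ℝ) ^ i.val * x (n + 1) := by
  have hs : (Function.support fun m : ℤ => haarG i m * x (n - m)) ⊆ ↑({0, -1} : Finset ℤ) := by
    intro m hm
    by_contra h
    simp only [Finset.coe_insert, Finset.coe_singleton, Set.mem_insert_iff,
      Set.mem_singleton_iff, not_or] at h
    exact hm (by simp [haarG, h.1, h.2])
  rw [conv, finsum_eq_sum_of_support_subset _ hs, Finset.sum_pair (by norm_num)]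
  simp [haarG]

theorem fbCoeff_haarG (i : ZMod 2) (x : ℤ → ℝ) (n : ℤ) :
    fbCoeff (haarG i) x n = x (2 * n) + (-1 : ℝ) ^ i.val * x (2 * n + 1) :=
  conv_haarG i x (2 * n)

theorem fbCoeff_haarG_add (i : ZMod 2) (x y : ℤ → ℝ) :
    fbCoeff (haarG i) (x + y) = fbCoeff (haarG i) x + fbCoeff (haarG i) y := by
  funext n
  simp only [fbCoeff_haarG, Pi.add_apply]
  ring

theorem fbCoeff_haarG_smul (i : ZMod 2) (c : ℝ) (x : ℤ → ℝ) :
    fbCoeff (haarG i) (c • x) = c • fbCoeff (haarG i) x := by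
  funext n
  simp only [fbCoeff_haarG, Pi.smul_apply, smul_eq_mul]
  ring

theorem mCoeff_haarG_add (L : ℕ) (i : Fin L → ZMod 2) (x y : ℤ → ℝ) :
    mCoeff haarG L i (x + y) = mCoeff haarG L i x + mCoeff haarG L i y := by
  induction L generalizing x y with
  | zero => rfl
  | succ L ih => simp only [mCoeff, fbCoeff_haarG_add, ih]

theorem mCoeff_haarG_smul (L : ℕ) (i : Fin L → ZMod 2) (c : ℝ) (x : ℤ → ℝ) :
    mCoeff haarG L i (c • x) = c • mCoeff haarG L i x := by
  induction L generalizing x with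
  | zero => rfl
  | succ L ih => simp only [mCoeff, fbCoeff_haarG_smul, ih]

/-- Subband convolution for one level of the Haar filterbank. -/
theorem fbCoeff_haarG_mul (i : ZMod 2) (x y : ℤ → ℝ) :
    fbCoeff (haarG i) (x * y) = (2 : ℝ)⁻¹ •
      (fbCoeff (haarG (i + 0)) x * fbCoeff (haarG 0) y +
        fbCoeff (haarG (i + 1)) x * fbCoeff (haarG 1) y) := by
  have h₀ : (0 : ZMod 2).val = 0 := rfl
  have h₁ : (1 : ZMod 2).val = 1 := rfl
  have h₂ : (1 + 1 : ZMod 2).val = 0 := rfl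
  funext n
  simp only [fbCoeff_haarG, Pi.mul_apply, Pi.add_apply, Pi.smul_apply, smul_eq_mul]
  obtain rfl | rfl : i = 0 ∨ i = 1 := by revert i; decide
  all_goals
    simp only [add_zero, zero_add, h₀, h₁, h₂, pow_zero, pow_one]
    ring

/-- Subband convolution for the Haar filterbank with any number of levels, including none. -/
theorem mCoeff_haarG_mul (L : ℕ) (i : Fin L → ZMod 2) (x y : ℤ → ℝ) (n : ℤ) :
    mCoeff haarG L i (x * y) n = ((2 : ℝ) ^ L)⁻¹ * ∑ j : Fin L → ZMod 2,
      mCoeff haarG L (i + j) x n * mCoeff haarG L j y n := by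
  induction L generalizing x y with
  | zero => simp [mCoeff]
  | succ L ih =>
    rw [← (Fin.consEquiv fun _ : Fin (L + 1) => ZMod 2).sum_comp, Fintype.sum_prod_type,
      show (Finset.univ : Finset (ZMod 2)) = {0, 1} from rfl, Finset.sum_pair (by decide)]
    simp only [mCoeff, fbCoeff_haarG_mul, mCoeff_haarG_smul, mCoeff_haarG_add, Pi.smul_apply,
      Pi.add_apply, smul_eq_mul, ih, Fin.consEquiv_apply, Fin.cons_zero, Fin.cons_succ]
    rw [pow_succ, mul_inv]
    simp only [Pi.add_def]
    ring

/-- Subband convolution for the Haar filterbank. -/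
theorem subband_convolution (L : ℕ) (x y : ℤ → ℝ)
    (i : Fin (L + 1) → ZMod 2) (n : ℤ) :
    mCoeff haarG (L + 1) i (fun m => x m * y m) n
      = ((2 : ℝ) ^ (L + 1))⁻¹ * ∑ j : Fin (L + 1) → ZMod 2,
          mCoeff haarG (L + 1) (i + j) x n * mCoeff haarG (L + 1) j y n := by
  exact mCoeff_haarG_mul (L + 1) i x y n
end
end
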